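/- For every p ∈ (1, ∞), the Hardy spaces H^{1,p}(μ) and H^{1,∞}(μ) coincide as sets, and there exists a constant C_p > 0 such that ‖f‖_{H^{1,p}} ≤ ‖f‖_{H^{1,∞}} ≤ C_p ‖f‖_{H^{1,p}} for every f ∈ H^{1,p}(μ). -/

import Mathlib

open MeasureTheory Set ENNReal Filter Function

/-- A weighted homogeneous tree setting: the homogeneous tree of order `m+1`
(a connected acyclic graph in which every vertex has `m+1` neighbours),
with a fixed doubly infinite geodesic `geo`, a numeration `idx` of `geo`,
the associated level function `level`, and the weighted measure `μ`
with `μ {x} = m ^ level x`. -/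
structure HomTreeSetting (m : ℕ) : Type 1 where
  V : Type
  measV : MeasurableSpace V
  measTop : measV = ⊤
  hm : 2 ≤ m
  G : SimpleGraph V
  conn : G.Connected
  acyclic : G.IsAcyclic
  deg : ∀ x : V, (G.neighborSet x).ncard = m + 1
  geo : Set V
  geoNbrs : ∀ v ∈ geo, (G.neighborSet v ∩ geo).ncard = 2
  geoGeodesic : ∀ u ∈ geo, ∀ v ∈ geo, ∀ w : V,
    G.dist u w + G.dist w v = G.dist u v → w ∈ geo
  idx : geo → ℤ
  idxBij : Function.Bijective idx
  idxDist : ∀ x y : geo, |idx x - idx y| = (G.dist x.1 y.1 : ℤ)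
  level : V → ℤ
  levelSpec : ∀ x : V, ∃ x' : geo,
    (∀ z : geo, G.dist x x'.1 ≤ G.dist x z.1) ∧
    level x = idx x' - (G.dist x x'.1 : ℤ)
  μ : @MeasureTheory.Measure V measV
  μspec : ∀ s : Set V, μ s = ∑' x : s, (m : ℝ≥0∞) ^ (level x.1)

attribute [instance] HomTreeSetting.measV

namespace HomTreeSetting

variable {m : ℕ}

/-- `x` lies below `y`. -/
def Below (S : HomTreeSetting m) (x y : S.V) : Prop :=
  S.level x = S.level y - (S.G.dist x y : ℤ)

/-- An admissible trapezoid: either degenerate (a singleton, with height 1) or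
the set of vertices lying below `root` whose level gap lies in `[ht, 2*ht)`. -/
structure AdmTrap (S : HomTreeSetting m) where
  root : S.V
  ht : ℕ
  ht_pos : 1 ≤ ht
  degen : Bool
  degen_ht : degen = true → ht = 1

variable {S : HomTreeSetting m}

/-- The underlying set of vertices of an admissible trapezoid. -/
def AdmTrap.set (R : S.AdmTrap) : Set S.V :=
  if R.degen then {R.root}
  else {x | S.Below x R.root ∧ (R.ht : ℤ) ≤ S.level R.root - S.level x ∧
    S.level R.root - S.level x < 2 * (R.ht : ℤ)}

/-- The envelope (Calderón–Zygmund set) of an admissible trapezoid. -/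
def AdmTrap.env (R : S.AdmTrap) : Set S.V :=
  if R.degen then {R.root}
  else {x | S.Below x R.root ∧ (R.ht : ℤ) ≤ 2 * (S.level R.root - S.level x) ∧
    S.level R.root - S.level x < 4 * (R.ht : ℤ)}

/-- The width `w(R) = m ^ ℓ(x_R)` of an admissible trapezoid. -/
noncomputable def AdmTrap.width (R : S.AdmTrap) : ℝ≥0∞ :=
  (m : ℝ≥0∞) ^ (S.level R.root)

/-- The dilated set `R̃* = {x : d(x, R̃) < h(R̃)/4}` of a Calderón–Zygmund set. -/
def AdmTrap.star (R : S.AdmTrap) : Set S.V :=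
  {x | ∃ y ∈ R.env, 4 * S.G.dist x y < R.ht}

variable (S)

/-- `E` is a Calderón–Zygmund set, i.e. the envelope of an admissible trapezoid. -/
def IsCZ (E : Set S.V) : Prop := ∃ R : S.AdmTrap, E = R.env

/-- Average of `f` over the set `E` with respect to `μ`. -/
noncomputable def avg (f : S.V → ℂ) (E : Set S.V) : ℂ :=
  (S.μ E).toReal⁻¹ • ∫ x in E, f x ∂S.μ

/-- The `q`-mean oscillation `(μ(E)⁻¹ ∫_E |f - f_E|^q dμ)^(1/q)` of `f` on `E`. -/
noncomputable def osc (q : ℝ) (f : S.V → ℂ) (E : Set S.V) : ℝ :=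
  ((S.μ E).toReal⁻¹ * ∫ x in E, ‖f x - S.avg f E‖ ^ q ∂S.μ) ^ (1 / q)

/-- The `BMO_q(μ)` (semi)norm. -/
noncomputable def bmoNorm (q : ℝ) (f : S.V → ℂ) : ℝ :=
  ⨆ R : S.AdmTrap, S.osc q f R.env

/-- Membership in `BMO_q(μ)`. -/
def MemBMO (q : ℝ) (f : S.V → ℂ) : Prop :=
  BddAbove (Set.range fun R : S.AdmTrap => S.osc q f R.env)

/-- A `(1,p)`-atom (`p = ⊤` gives `(1,∞)`-atoms). -/
def IsAtom (p : ℝ≥0∞) (a : S.V → ℂ) : Prop :=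
  ∃ R : S.AdmTrap, Function.support a ⊆ R.env ∧
    eLpNorm a p S.μ ≤ S.μ R.env ^ ((p⁻¹).toReal - 1) ∧
    ∫ x, a x ∂S.μ = 0

/-- `f = ∑ j, c j • a j` is an atomic decomposition of `f` with `(1,p)`-atoms
`a j` and `∑ j, ‖c j‖ < ∞`, the series converging to `f` in `L¹(μ)`. -/
def IsAtomicDecomp (p : ℝ≥0∞) (f : S.V → ℂ) (c : ℕ → ℂ) (a : ℕ → S.V → ℂ) : Prop :=
  (∀ j, S.IsAtom p (a j)) ∧ Summable (fun j => ‖c j‖) ∧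
  Filter.Tendsto
    (fun n => eLpNorm (fun x => f x - ∑ j ∈ Finset.range n, c j * a j x) 1 S.μ)
    Filter.atTop (nhds 0)

/-- Membership in the atomic Hardy space `H^{1,p}(μ)`. -/
def MemH1 (p : ℝ≥0∞) (f : S.V → ℂ) : Prop :=
  MeasureTheory.Integrable f S.μ ∧ ∃ c a, S.IsAtomicDecomp p f c a

/-- The `H^{1,p}(μ)` norm: infimum of `∑ j, ‖c j‖` over atomic decompositions. -/
noncomputable def h1Norm (p : ℝ≥0∞) (f : S.V → ℂ) : ℝ :=
  sInf {t : ℝ | ∃ c a, S.IsAtomicDecomp p f c a ∧ t = ∑' j, ‖c j‖}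

/-- Membership in `H^{1,p}_fin(μ)`: finite linear combinations of `(1,p)`-atoms. -/
def MemH1fin (p : ℝ≥0∞) (f : S.V → ℂ) : Prop :=
  ∃ (n : ℕ) (c : ℕ → ℂ) (a : ℕ → S.V → ℂ),
    (∀ j, j < n → S.IsAtom p (a j)) ∧
    f = fun x => ∑ j ∈ Finset.range n, c j * a j x

/-- The sharp maximal function `f^{♯,q}`. -/
noncomputable def sharpMax (q : ℝ) (f : S.V → ℂ) (x : S.V) : ℝ :=
  ⨆ R : {R : S.AdmTrap // x ∈ R.env}, S.osc q f R.1.env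

end HomTreeSetting

theorem List.sum_map_eq_sum_range_getD {α M : Type*} [AddCommMonoid M] (L : List α) (d : α)
    (f : α → M) : (L.map f).sum = ∑ j ∈ Finset.range L.length, f (L.getD j d) := by
  induction L with
  | nil => simp
  | cons u L ih => simp [Finset.sum_range_succ', ih, add_comm]

theorem SimpleGraph.IsAcyclic.eq_of_dist_add_one_eq {V : Type*} {G : SimpleGraph V}
    (hG : G.IsAcyclic) (hc : G.Connected) {r x y z : V} (hy : G.Adj y x) (hz : G.Adj z x)
    (hdy : G.dist r y + 1 = G.dist r x) (hdz : G.dist r z + 1 = G.dist r x) : y = z := by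
  obtain ⟨p, hp⟩ := hc.exists_walk_length_eq_dist r y
  obtain ⟨q, hq⟩ := hc.exists_walk_length_eq_dist r z
  have hp' : (p.concat hy).IsPath := SimpleGraph.Walk.isPath_of_length_eq_dist _ (by
    rw [SimpleGraph.Walk.length_concat, hp, hdy])
  have hq' : (q.concat hz).IsPath := SimpleGraph.Walk.isPath_of_length_eq_dist _ (by
    rw [SimpleGraph.Walk.length_concat, hq, hdz])
  have h := congrArg (fun w : G.Path r x => w.1.penultimate)
    ((hG.subsingleton_path r x).elim ⟨_, hp'⟩ ⟨_, hq'⟩)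
  simpa using h

namespace HomTreeSetting

variable {m : ℕ} (S : HomTreeSetting m)

theorem isTree : S.G.IsTree := ⟨S.conn, S.acyclic⟩

/-- The vertex of the distinguished geodesic with index `n`. -/
noncomputable def geoPt (n : ℤ) : S.V := ((Equiv.ofBijective S.idx S.idxBij).symm n).1

theorem dist_geoPt (i j : ℤ) : (S.G.dist (S.geoPt i) (S.geoPt j) : ℤ) = |i - j| := by
  have h := S.idxDist ((Equiv.ofBijective S.idx S.idxBij).symm i)
    ((Equiv.ofBijective S.idx S.idxBij).symm j)
  have e (n : ℤ) : S.idx ((Equiv.ofBijective S.idx S.idxBij).symm n) = n :=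
    (Equiv.ofBijective S.idx S.idxBij).apply_symm_apply n
  rw [e, e] at h
  exact h.symm

theorem adj_geoPt (n : ℤ) : S.G.Adj (S.geoPt n) (S.geoPt (n + 1)) := by
  simpa using S.dist_geoPt n (n + 1)

theorem exists_level_eq_sub_dist (x : S.V) :
    ∃ N : ℤ, ∀ n ≥ N, S.level x = n - S.G.dist x (S.geoPt n) := by
  obtain ⟨x', hmin, hlev⟩ := S.levelSpec x
  have hx' : S.geoPt (S.idx x') = x'.1 := by
    simp only [geoPt]
    congr 1
    exact (Equiv.ofBijective S.idx S.idxBij).symm_apply_apply x'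
  have hmin' (n : ℤ) : S.G.dist x (S.geoPt (S.idx x')) ≤ S.G.dist x (S.geoPt n) := by
    rw [hx']; exact hmin _
  refine ⟨S.idx x', fun n hn => ?_⟩
  have key : ∀ k : ℕ, S.G.dist x (S.geoPt (S.idx x' + k)) =
        S.G.dist x (S.geoPt (S.idx x')) + k ∧
      S.G.dist x (S.geoPt (S.idx x' + k + 1)) =
        S.G.dist x (S.geoPt (S.idx x')) + k + 1 := by
    intro k
    induction k with
    | zero =>
      have h1 := S.isTree.dist_eq_dist_add_one_of_adj x (S.adj_geoPt (S.idx x'))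
      have h2 := hmin' (S.idx x' + 1)
      simp only [Nat.cast_zero, add_zero, true_and]
      omega
    | succ k ih =>
      obtain ⟨ih1, ih2⟩ := ih
      push_cast
      rw [← add_assoc]
      refine ⟨ih2, ?_⟩
      have a1 := S.adj_geoPt (S.idx x' + k)
      have a2 := S.adj_geoPt (S.idx x' + k + 1)
      rcases S.isTree.dist_eq_dist_add_one_of_adj x a2 with h | h
      · exfalso
        have := S.acyclic.eq_of_dist_add_one_eq S.conn a1 a2.symm
          (by rw [ih1, ih2]) h.symm
        have hd := S.dist_geoPt (S.idx x' + k) (S.idx x' + k + 1 + 1)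
        rw [this] at hd
        rw [S.dist_geoPt] at hd
        ring_nf at hd
        norm_num at hd
      · omega
  have hk := (key (n - S.idx x').toNat).1
  have hn' : S.idx x' + ((n - S.idx x').toNat : ℤ) = n := by omega
  rw [hn', hx'] at hk
  omega

theorem level_eq_or_of_adj {x y : S.V} (h : S.G.Adj x y) :
    S.level x = S.level y + 1 ∨ S.level y = S.level x + 1 := by
  obtain ⟨N, hN⟩ := S.exists_level_eq_sub_dist x
  obtain ⟨M, hM⟩ := S.exists_level_eq_sub_dist y
  have h1 := hN (max N M) (le_max_left _ _)
  have h2 := hM (max N M) (le_max_right _ _)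
  rw [SimpleGraph.dist_comm] at h1 h2
  have := S.isTree.dist_eq_dist_add_one_of_adj (S.geoPt (max N M)) h
  omega

theorem existsUnique_adj_level (x : S.V) :
    ∃! y, S.G.Adj x y ∧ S.level y = S.level x + 1 := by
  obtain ⟨N, hN⟩ := S.exists_level_eq_sub_dist x
  refine existsUnique_of_exists_of_unique ?_ ?_
  · obtain ⟨n, hn⟩ : ∃ n, n = max N (S.level x + 1) := ⟨_, rfl⟩
    have h1 := hN n (hn ▸ le_max_left _ _)
    have h2 : S.level x + 1 ≤ n := hn ▸ le_max_right _ _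
    obtain ⟨p, hp⟩ := S.conn.exists_walk_length_eq_dist x (S.geoPt n)
    generalize hz : S.geoPt n = z at p hp h1
    cases p with
    | nil =>
      rw [SimpleGraph.dist_self] at h1
      omega
    | @cons _ v _ hv q =>
      refine ⟨v, hv, ?_⟩
      rw [SimpleGraph.Walk.length_cons] at hp
      have hq := SimpleGraph.dist_le q
      obtain ⟨M, hM⟩ := S.exists_level_eq_sub_dist v
      have h3 := hM (max n M) (le_max_right _ _)
      subst hz
      have ht := S.conn.dist_triangle (u := v) (v := S.geoPt n) (w := S.geoPt (max n M))
      have hd := S.dist_geoPt n (max n M)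
      rw [abs_of_nonpos (by have := le_max_left n M; omega)] at hd
      have := S.level_eq_or_of_adj hv
      omega
  · rintro y z ⟨hy, hly⟩ ⟨hz, hlz⟩
    obtain ⟨M, hM⟩ := S.exists_level_eq_sub_dist y
    obtain ⟨K, hK⟩ := S.exists_level_eq_sub_dist z
    have h1 := hN (max N (max M K)) (by simp)
    have h2 := hM (max N (max M K)) (by simp)
    have h3 := hK (max N (max M K)) (by simp)
    rw [SimpleGraph.dist_comm] at h1 h2 h3
    exact S.acyclic.eq_of_dist_add_one_eq S.conn (r := S.geoPt (max N (max M K))) hy.symm hz.symm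
      (by omega) (by omega)

/-- The parent of a vertex: its only neighbour lying one level higher. -/
noncomputable def parent (x : S.V) : S.V := (S.existsUnique_adj_level x).exists.choose

theorem adj_parent (x : S.V) : S.G.Adj x (S.parent x) :=
  (S.existsUnique_adj_level x).exists.choose_spec.1

theorem level_parent (x : S.V) : S.level (S.parent x) = S.level x + 1 :=
  (S.existsUnique_adj_level x).exists.choose_spec.2

theorem parent_eq {x y : S.V} (h : S.G.Adj x y) (hl : S.level y = S.level x + 1) :
    S.parent x = y :=
  (S.existsUnique_adj_level x).unique ⟨S.adj_parent x, S.level_parent x⟩ ⟨h, hl⟩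

theorem level_iterate_parent (k : ℕ) (x : S.V) :
    S.level (S.parent^[k] x) = S.level x + k := by
  induction k with
  | zero => simp
  | succ k ih => rw [iterate_succ_apply', level_parent, ih]; push_cast; ring

theorem level_sub_le_length {x y : S.V} (p : S.G.Walk x y) :
    S.level y - S.level x ≤ p.length := by
  induction p with
  | nil => simp
  | cons h q ih =>
    have := S.level_eq_or_of_adj h
    rw [SimpleGraph.Walk.length_cons]
    push_cast
    omega

theorem level_sub_le_dist (x y : S.V) : S.level y - S.level x ≤ S.G.dist x y := by
  obtain ⟨p, hp⟩ := S.conn.exists_walk_length_eq_dist x y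
  rw [← hp]
  exact S.level_sub_le_length p

theorem dist_iterate_parent_le (k : ℕ) (x : S.V) : S.G.dist x (S.parent^[k] x) ≤ k := by
  induction k with
  | zero => simp
  | succ k ih =>
    rw [iterate_succ_apply']
    have h := S.conn.dist_triangle (u := x) (v := S.parent^[k] x) (w := S.parent (S.parent^[k] x))
    rw [SimpleGraph.dist_eq_one_iff_adj.2 (S.adj_parent _)] at h
    omega

theorem below_iff {x y : S.V} : S.Below x y ↔ ∃ k, S.parent^[k] x = y := by
  constructor
  · intro h
    obtain ⟨p, hp⟩ := S.conn.exists_walk_length_eq_dist x y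
    have h' : S.level y - S.level x = p.length := by rw [hp, h]; ring
    clear h hp
    induction p with
    | nil => exact ⟨0, rfl⟩
    | cons h q ih =>
      have h1 := S.level_sub_le_length q
      have h2 := S.level_eq_or_of_adj h
      rw [SimpleGraph.Walk.length_cons] at h'
      push_cast at h'
      obtain ⟨k, hk⟩ := ih (by omega)
      exact ⟨k + 1, by rw [iterate_succ_apply, S.parent_eq h (by omega), hk]⟩
  · rintro ⟨k, rfl⟩
    have h1 := S.level_sub_le_dist x (S.parent^[k] x)
    have h2 := S.dist_iterate_parent_le k x
    have h3 := S.level_iterate_parent k x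
    unfold Below
    omega

theorem finite_neighborSet (x : S.V) : (S.G.neighborSet x).Finite :=
  Set.finite_of_ncard_pos (by rw [S.deg]; omega)

theorem setOf_parent_eq (x : S.V) :
    {y | S.parent y = x} = S.G.neighborSet x \ {S.parent x} := by
  ext y
  simp only [mem_ofPred_eq, Set.mem_sdiff, SimpleGraph.mem_neighborSet, mem_singleton_iff]
  constructor
  · rintro rfl
    refine ⟨(S.adj_parent y).symm, fun h => ?_⟩
    have h1 := S.level_parent y
    have h2 := S.level_parent (S.parent y)
    rw [← h] at h2
    omega
  · rintro ⟨h, hne⟩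
    rcases S.level_eq_or_of_adj h with hl | hl
    · exact S.parent_eq h.symm hl
    · exact absurd (S.parent_eq h hl).symm hne

theorem finite_setOf_parent_eq (x : S.V) : {y | S.parent y = x}.Finite := by
  rw [setOf_parent_eq]
  exact (S.finite_neighborSet x).sdiff

/-- The children of a vertex. -/
noncomputable def children (x : S.V) : Finset S.V := (S.finite_setOf_parent_eq x).toFinset

variable {S} in
@[simp] theorem mem_children {x y : S.V} : y ∈ S.children x ↔ S.parent y = x := by
  simp [children]

theorem card_children (x : S.V) : (S.children x).card = m := by
  have h : S.parent x ∈ S.G.neighborSet x := S.adj_parent x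
  rw [children, ← Set.ncard_eq_toFinset_card _ (S.finite_setOf_parent_eq x), setOf_parent_eq,
    Set.ncard_sdiff_singleton_of_mem h, S.deg]
  simp

instance : MeasurableSingletonClass S.V :=
  ⟨fun x => by rw [S.measTop]; exact MeasurableSpace.measurableSet_top⟩

/-- The mass of a vertex. -/
noncomputable def wt (x : S.V) : ℝ := S.μ.real {x}

theorem measure_singleton (x : S.V) : S.μ {x} = (m : ℝ≥0∞) ^ S.level x := by
  rw [S.μspec, tsum_singleton x (fun y => (m : ℝ≥0∞) ^ S.level y)]

theorem natCast_ne_zero {m : ℕ} (S : HomTreeSetting m) : (m : ℝ≥0∞) ≠ 0 := by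
  have := S.hm
  simp
  omega

theorem measure_singleton_ne_top (x : S.V) : S.μ {x} ≠ ∞ := by
  rw [measure_singleton]
  exact (ENNReal.zpow_lt_top S.natCast_ne_zero (ENNReal.natCast_ne_top m) _).ne

theorem wt_pos (x : S.V) : 0 < S.wt x := by
  refine ENNReal.toReal_pos ?_ (S.measure_singleton_ne_top x)
  rw [measure_singleton]
  exact (ENNReal.zpow_pos S.natCast_ne_zero (ENNReal.natCast_ne_top m) _).ne'

theorem wt_parent (x : S.V) : S.wt (S.parent x) = m * S.wt x := by
  rw [wt, wt, Measure.real, Measure.real, measure_singleton, measure_singleton, level_parent,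
    ENNReal.zpow_add S.natCast_ne_zero (ENNReal.natCast_ne_top m), zpow_one, ENNReal.toReal_mul,
    ENNReal.toReal_natCast, mul_comm]

/-- The total mass of a finite set of vertices. -/
noncomputable def vol (Q : Finset S.V) : ℝ := ∑ x ∈ Q, S.wt x

theorem measure_finset_ne_top (Q : Finset S.V) : S.μ Q ≠ ∞ := by
  rw [← sum_measure_singleton]
  exact (ENNReal.sum_lt_top.2 fun x _ => (S.measure_singleton_ne_top x).lt_top).ne

theorem measureReal_finset (Q : Finset S.V) : S.μ.real Q = S.vol Q := by
  rw [vol, Measure.real, ← sum_measure_singleton,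
    ENNReal.toReal_sum fun x _ => S.measure_singleton_ne_top x]
  rfl

theorem vol_nonneg (Q : Finset S.V) : 0 ≤ S.vol Q :=
  Finset.sum_nonneg fun x _ => (S.wt_pos x).le

theorem vol_singleton (x : S.V) : S.vol {x} = S.wt x := Finset.sum_singleton _ _

theorem two_le_cast {m : ℕ} (S : HomTreeSetting m) : (2 : ℝ) ≤ m := by exact_mod_cast S.hm

open scoped Classical in
/-- The descendants of `x` lying `k` levels below `x`. -/
noncomputable def desc : ℕ → S.V → Finset S.V
  | 0, x => {x}
  | k + 1, x => (S.children x).biUnion (desc k)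

variable {S} in
theorem mem_desc {k : ℕ} {x z : S.V} : z ∈ S.desc k x ↔ S.parent^[k] z = x := by
  induction k generalizing x with
  | zero => simp [desc]
  | succ k ih =>
    classical
    rw [desc, Finset.mem_biUnion, iterate_succ_apply']
    simp only [mem_children, ih]
    simp

theorem iterate_parent_injective {x : S.V} {j k : ℕ} (h : S.parent^[j] x = S.parent^[k] x) :
    j = k := by
  have h1 := S.level_iterate_parent j x
  have h2 := S.level_iterate_parent k x
  rw [h] at h1
  omega

theorem vol_desc (k : ℕ) (x : S.V) : S.vol (S.desc k x) = S.wt x := by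
  classical
  induction k generalizing x with
  | zero => exact S.vol_singleton x
  | succ k ih =>
    have hd : ((S.children x : Finset S.V) : Set S.V).PairwiseDisjoint (S.desc k) := by
      intro y _ z _ hyz
      refine Finset.disjoint_left.2 fun u hu hu' => hyz ?_
      rw [mem_desc] at hu hu'
      rw [← hu, ← hu']
    have h : S.vol (S.desc (k + 1) x) = ∑ y ∈ S.children x, S.vol (S.desc k y) := by
      rw [vol, desc, Finset.sum_biUnion]
      · rfl
      · convert hd
    have hm := S.two_le_cast
    rw [h, Finset.sum_congr rfl fun y hy => (show _ = S.wt x / m by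
      rw [ih y, ← mem_children.1 hy, wt_parent]
      field_simp), Finset.sum_const, card_children, nsmul_eq_mul]
    field_simp

open scoped Classical in
/-- The vertices lying below `x` with level gap in `[s, t)`. -/
noncomputable def trap (x : S.V) (s t : ℕ) : Finset S.V :=
  (Finset.Ico s t).biUnion fun k => S.desc k x

variable {S} in
theorem mem_trap {x z : S.V} {s t : ℕ} :
    z ∈ S.trap x s t ↔ ∃ k, (s ≤ k ∧ k < t) ∧ S.parent^[k] z = x := by
  simp [trap, mem_desc]

theorem vol_trap (x : S.V) (s t : ℕ) : S.vol (S.trap x s t) = (t - s : ℕ) * S.wt x := by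
  classical
  rw [vol, trap, Finset.sum_biUnion]
  · exact (Finset.sum_congr rfl fun k _ => S.vol_desc k x).trans (by simp)
  · intro j _ k _ hjk
    refine Finset.disjoint_left.2 fun u hu hu' => hjk ?_
    rw [mem_desc] at hu hu'
    exact S.iterate_parent_injective (hu.trans hu'.symm)

theorem env_of_degen {R : S.AdmTrap} (h : R.degen = true) : R.env = {R.root} := by
  simp [AdmTrap.env, h]

theorem env_of_not_degen {R : S.AdmTrap} (h : R.degen = false) :
    R.env = S.trap R.root ((R.ht + 1) / 2) (4 * R.ht) := by
  ext z
  simp only [AdmTrap.env, h, Bool.false_eq_true, if_false, Finset.mem_coe, mem_trap,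
    mem_ofPred_eq, below_iff]
  constructor
  · rintro ⟨⟨k, hk⟩, h1, h2⟩
    have := S.level_iterate_parent k z
    rw [hk] at this
    exact ⟨k, by omega, hk⟩
  · rintro ⟨k, hk, hz⟩
    have := S.level_iterate_parent k z
    rw [hz] at this
    exact ⟨⟨k, hz⟩, by omega, by omega⟩

theorem isCZ_trap (x : S.V) {s : ℕ} (hs : 1 ≤ s) : S.IsCZ (S.trap x s (8 * s)) := by
  refine ⟨⟨x, 2 * s, by omega, false, by simp⟩, ?_⟩
  rw [S.env_of_not_degen rfl]
  congr 2
  all_goals simp only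
  all_goals omega

/-- Finite sets which can be split repeatedly, in a regular way, into sets comparable to
Calderón–Zygmund sets, until singletons are reached. -/
inductive Dyadic : Finset S.V → Prop
  | singleton (x : S.V) : Dyadic {x}
  | node (Q : Finset S.V) {ι : Type} (I : Finset ι) (P : ι → Finset S.V)
      (mem_iff : ∀ z, z ∈ Q ↔ ∃ i ∈ I, z ∈ P i)
      (disj : ∀ i ∈ I, ∀ j ∈ I, ∀ z, z ∈ P i → z ∈ P j → i = j)
      (dyadic : ∀ i ∈ I, Dyadic (P i))
      (regular : ∀ i ∈ I, S.vol Q ≤ 2 * m ^ 2 * S.vol (P i))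
      (comparable : ∃ E : Finset S.V, S.IsCZ E ∧ Q ⊆ E ∧ S.vol E ≤ 7 * S.vol Q) : Dyadic Q

theorem exists_isCZ_trap_subset (x : S.V) {s t : ℕ} (hs : 1 ≤ s) (h1 : 2 * s ≤ t)
    (h2 : t ≤ 8 * s) : ∃ E : Finset S.V, S.IsCZ E ∧ S.trap x s t ⊆ E ∧
      S.vol E ≤ 7 * S.vol (S.trap x s t) := by
  refine ⟨S.trap x s (8 * s), S.isCZ_trap x hs, fun z hz => ?_, ?_⟩
  · rw [mem_trap] at hz ⊢
    obtain ⟨k, hk, hz⟩ := hz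
    exact ⟨k, by omega, hz⟩
  · rw [vol_trap, vol_trap, ← mul_assoc]
    refine mul_le_mul_of_nonneg_right ?_ (S.wt_pos x).le
    norm_cast
    omega

theorem dyadic_trap (x : S.V) {s t : ℕ} (hs : 1 ≤ s) (h1 : 2 * s ≤ t) (h2 : t ≤ 8 * s) :
    S.Dyadic (S.trap x s t) := by
  have hm := S.two_le_cast
  have hm2 : (4 : ℝ) ≤ m ^ 2 := by nlinarith
  induction hn : 2 * t - s using Nat.strong_induction_on generalizing x s t with
  | _ n ih =>
  subst hn
  have hE := S.exists_isCZ_trap_subset x hs h1 h2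
  have hx := S.wt_pos x
  rcases le_or_gt (4 * s) t with h4 | h4
  · refine .node _ Finset.univ (fun b : Bool => if b then S.trap x s (2 * s)
      else S.trap x (2 * s) t) (fun z => ?_) ?_ ?_ ?_ hE
    · simp only [mem_trap, Finset.mem_univ, true_and, Bool.exists_bool, if_true,
        Bool.false_eq_true, if_false]
      constructor
      · rintro ⟨k, hk, hz⟩
        rcases lt_or_ge k (2 * s) with h | h
        · exact Or.inr ⟨k, by omega, hz⟩
        · exact Or.inl ⟨k, by omega, hz⟩
      · rintro (⟨k, hk, hz⟩ | ⟨k, hk, hz⟩)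
        · exact ⟨k, by omega, hz⟩
        · exact ⟨k, by omega, hz⟩
    · have key : ∀ z, z ∈ S.trap x s (2 * s) → z ∈ S.trap x (2 * s) t → False := by
        intro z hz hz'
        obtain ⟨j, hj, hz⟩ := mem_trap.1 hz
        obtain ⟨k, hk, hz'⟩ := mem_trap.1 hz'
        have := S.iterate_parent_injective (hz.trans hz'.symm)
        omega
      rintro (_ | _) _ (_ | _) _ z hz hz'
      · rfl
      · exact (key z hz' hz).elim
      · exact (key z hz hz').elim
      · rfl
    · rintro (_ | _) _
      · exact ih _ (by omega) x (by omega) (by omega) (by omega) rfl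
      · exact ih _ (by omega) x (by omega) (by omega) (by omega) rfl
    · have e1 : ((t - s : ℕ) : ℝ) ≤ 8 * ((2 * s - s : ℕ) : ℝ) := by norm_cast; omega
      have e2 : ((t - s : ℕ) : ℝ) ≤ 8 * ((t - 2 * s : ℕ) : ℝ) := by norm_cast; omega
      rintro (_ | _) _
      · simp only [Bool.false_eq_true, if_false, vol_trap]
        rw [← mul_assoc]
        refine mul_le_mul_of_nonneg_right (e2.trans ?_) hx.le
        gcongr
        linarith
      · simp only [if_true, vol_trap]
        rw [← mul_assoc]
        refine mul_le_mul_of_nonneg_right (e1.trans ?_) hx.le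
        gcongr
        linarith
  · rcases hs.eq_or_lt with rfl | hs'
    · have ht : t = 2 ∨ t = 3 := by omega
      refine .node _ (S.trap x 1 t) (fun z => {z}) (by simp) ?_
        (fun z _ => .singleton z) (fun z hz => ?_) hE
      · intro y _ z _ u hy hz
        rw [Finset.mem_singleton] at hy hz
        exact hy.symm.trans hz
      · obtain ⟨k, hk, rfl⟩ := mem_trap.1 hz
        have hw := S.wt_pos z
        rw [vol_trap, vol_singleton]
        have hkk : S.wt (S.parent^[k] z) ≤ m ^ 2 * S.wt z := by
          have : k = 1 ∨ k = 2 := by omega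
          rcases this with rfl | rfl
          · rw [iterate_one, wt_parent]
            exact mul_le_mul_of_nonneg_right (by nlinarith) hw.le
          · rw [iterate_succ_apply', iterate_one, wt_parent, wt_parent]
            nlinarith
        have ht' : ((t - 1 : ℕ) : ℝ) ≤ 2 := by norm_cast; omega
        calc ((t - 1 : ℕ) : ℝ) * S.wt (S.parent^[k] z) ≤ 2 * (m ^ 2 * S.wt z) := by gcongr
          _ = _ := by ring
    · refine .node _ (S.children x) (fun y => S.trap y (s - 1) (t - 1)) (fun z => ?_) ?_ ?_ ?_ hE
      · simp only [mem_trap, mem_children]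
        constructor
        · rintro ⟨k, hk, hz⟩
          obtain ⟨j, rfl⟩ : ∃ j, k = j + 1 := ⟨k - 1, by omega⟩
          exact ⟨S.parent^[j] z, by rw [← hz, iterate_succ_apply'], j, by omega, rfl⟩
        · rintro ⟨y, hy, k, hk, hz⟩
          exact ⟨k + 1, by omega, by rw [iterate_succ_apply', hz, hy]⟩
      · intro y hy y' hy' z hz hz'
        obtain ⟨j, hj, hz⟩ := mem_trap.1 hz
        obtain ⟨k, hk, hz'⟩ := mem_trap.1 hz'
        rw [mem_children] at hy hy'
        have : j + 1 = k + 1 := S.iterate_parent_injective (x := z) (by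
          rw [iterate_succ_apply', iterate_succ_apply', hz, hz', hy, hy'])
        obtain rfl : j = k := by omega
        rw [← hz, hz']
      · intro y _
        exact ih _ (by omega) y (by omega) (by omega) (by omega) rfl
      · intro y hy
        rw [mem_children] at hy
        have hyp := S.wt_pos y
        rw [vol_trap, vol_trap, ← hy, wt_parent]
        have e : t - 1 - (s - 1) = t - s := by omega
        rw [e, mul_left_comm ((t - s : ℕ) : ℝ)]
        refine mul_le_mul_of_nonneg_right ?_ (by positivity)
        nlinarith

theorem exists_dyadic_eq_env (R : S.AdmTrap) :
    ∃ Q : Finset S.V, S.Dyadic Q ∧ (Q : Set S.V) = R.env := by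
  cases h : R.degen with
  | true => exact ⟨{R.root}, .singleton _, by rw [S.env_of_degen h, Finset.coe_singleton]⟩
  | false =>
    have := R.ht_pos
    exact ⟨_, S.dyadic_trap R.root (by omega) (by omega) (by omega), (S.env_of_not_degen h).symm⟩

theorem measurable {m : ℕ} (S : HomTreeSetting m) {β : Type*} [MeasurableSpace β] (f : S.V → β) :
    Measurable f := fun s _ => by rw [S.measTop]; exact MeasurableSpace.measurableSet_top

theorem integrable_of_support_subset {f : S.V → ℂ} {Q : Finset S.V} (h : support f ⊆ Q) :
    Integrable f S.μ := by
  rw [← integrableOn_iff_integrable_of_support_subset h]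
  refine ⟨(S.measurable f).aestronglyMeasurable, ?_⟩
  rw [HasFiniteIntegral, lintegral_finset]
  exact ENNReal.sum_lt_top.2 fun x _ =>
    ENNReal.mul_lt_top (by simp) (S.measure_singleton_ne_top x).lt_top

theorem integral_eq_sum {f : S.V → ℂ} {Q : Finset S.V} (h : support f ⊆ Q) :
    ∫ x, f x ∂S.μ = ∑ x ∈ Q, (S.wt x : ℂ) * f x := by
  rw [← setIntegral_eq_integral_of_forall_compl_eq_zero (s := Q) fun x hx =>
    notMem_support.1 fun hx' => hx (h hx'),
    setIntegral_finset _ (S.integrable_of_support_subset h).integrableOn]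
  rfl

theorem vol_pos_of_isCZ {m : ℕ} {S : HomTreeSetting m} {E : Finset S.V} (h : S.IsCZ E) :
    0 < S.vol E := by
  obtain ⟨R, hR⟩ := h
  have hx := S.wt_pos R.root
  cases hd : R.degen with
  | true =>
    rw [S.env_of_degen hd, Finset.coe_eq_singleton] at hR
    rwa [hR, vol_singleton]
  | false =>
    rw [S.env_of_not_degen hd, Finset.coe_inj] at hR
    have := R.ht_pos
    rw [hR, vol_trap]
    exact mul_pos (by norm_cast; omega) hx

/-- `b` is a finite combination of `(1,∞)`-atoms with coefficients of total size at most `A`. -/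
def AtomicCost (b : S.V → ℂ) (A : ℝ) : Prop :=
  ∃ L : List (ℂ × (S.V → ℂ)), (∀ u ∈ L, S.IsAtom ⊤ u.2) ∧
    b = (L.map fun u => u.1 • u.2).sum ∧ (L.map fun u => ‖u.1‖).sum ≤ A

variable {S}

theorem AtomicCost.zero {A : ℝ} (hA : 0 ≤ A) : S.AtomicCost 0 A :=
  ⟨[], by simp, by simp, by simpa⟩

theorem AtomicCost.add {b c : S.V → ℂ} {A B : ℝ} (hb : S.AtomicCost b A)
    (hc : S.AtomicCost c B) : S.AtomicCost (b + c) (A + B) := by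
  obtain ⟨L, h1, rfl, h2⟩ := hb
  obtain ⟨M, h3, rfl, h4⟩ := hc
  refine ⟨L ++ M, ?_, by simp, ?_⟩
  · intro u hu
    rcases List.mem_append.1 hu with h | h
    · exact h1 u h
    · exact h3 u h
  · rw [List.map_append, List.sum_append]
    exact add_le_add h2 h4

theorem AtomicCost.mono {b : S.V → ℂ} {A B : ℝ} (hb : S.AtomicCost b A) (h : A ≤ B) :
    S.AtomicCost b B := by
  obtain ⟨L, h1, h2, h3⟩ := hb
  exact ⟨L, h1, h2, h3.trans h⟩

theorem atomicCost_of_norm_le {E : Finset S.V} (hE : S.IsCZ E) {u : S.V → ℂ} {K : ℝ}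
    (hu : support u ⊆ E) (hK : ∀ x, ‖u x‖ ≤ K)
    (h0 : ∑ x ∈ E, (S.wt x : ℂ) * u x = 0) : S.AtomicCost u (K * S.vol E) := by
  have hv := vol_pos_of_isCZ hE
  obtain ⟨R, hR⟩ := hE
  rcases le_or_gt K 0 with hK0 | hK0
  · have hu0 : u = 0 := funext fun x => norm_le_zero_iff.1 ((hK x).trans hK0)
    have hx : ∃ x, x ∈ E := by
      by_contra! h
      rw [Finset.eq_empty_of_forall_notMem h] at hv
      simp [vol] at hv
    obtain ⟨x, -⟩ := hx
    have : K = 0 := le_antisymm hK0 ((norm_nonneg _).trans (hK x))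
    rw [hu0, this]
    exact .zero (by simp)
  · have hc : 0 < K * S.vol E := mul_pos hK0 hv
    refine ⟨[((K * S.vol E : ℝ), fun x => ((K * S.vol E : ℝ) : ℂ)⁻¹ * u x)], ?_, ?_, ?_⟩
    · intro v hv'
      obtain rfl := List.mem_singleton.1 hv'
      have hs : support (fun x => ((K * S.vol E : ℝ) : ℂ)⁻¹ * u x) ⊆ E := by
        intro x hx
        exact hu fun h => hx (by simp [h])
      refine ⟨R, hR ▸ hs, ?_, ?_⟩
      · have hb : ∀ x, ‖((K * S.vol E : ℝ) : ℂ)⁻¹ * u x‖ ≤ (S.vol E)⁻¹ := by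
          intro x
          rw [norm_mul, norm_inv, Complex.norm_real, Real.norm_of_nonneg hc.le, mul_inv]
          calc K⁻¹ * (S.vol E)⁻¹ * ‖u x‖ ≤ K⁻¹ * (S.vol E)⁻¹ * K := by gcongr; exact hK x
            _ = _ := by field_simp
        rw [eLpNorm_exponent_top]
        refine (eLpNormEssSup_le_of_ae_bound (ae_of_all _ hb)).trans ?_
        rw [← hR, ENNReal.inv_top, ENNReal.toReal_zero, zero_sub, ENNReal.rpow_neg_one,
          ENNReal.ofReal_inv_of_pos hv, ← measureReal_finset, Measure.real,
          ENNReal.ofReal_toReal (S.measure_finset_ne_top E)]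
      · rw [S.integral_eq_sum hs, Finset.sum_congr rfl fun x _ => mul_left_comm _ _ _,
          ← Finset.mul_sum, h0, mul_zero]
    · ext x
      have : ((K * S.vol E : ℝ) : ℂ) ≠ 0 := by exact_mod_cast hc.ne'
      simp only [List.map_cons, List.map_nil, List.sum_cons, List.sum_nil, add_zero, Pi.smul_apply,
        smul_eq_mul]
      rw [mul_inv_cancel_left₀ this]
    · simp [Complex.norm_real, abs_of_pos hK0, abs_of_pos hv]

variable (S)

/-- The unnormalized `q`-energy of `f` on `Q`. -/
noncomputable def energy (q : ℝ) (f : S.V → ℂ) (Q : Finset S.V) : ℝ :=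
  ∑ x ∈ Q, S.wt x * ‖f x‖ ^ q

/-- `f` is on `Q` the sum of a function bounded by `B * τ` with the same mean, and of a combination
of atoms with total coefficient `C * τ ^ (1 - q)` times the energy of `f`. -/
def HasSplitting (B C q τ : ℝ) (f : S.V → ℂ) (Q : Finset S.V) : Prop :=
  ∃ g : S.V → ℂ, (∀ x ∈ Q, ‖g x‖ ≤ B * τ) ∧
    ∑ x ∈ Q, (S.wt x : ℂ) * g x = ∑ x ∈ Q, (S.wt x : ℂ) * f x ∧
    S.AtomicCost ((Q : Set S.V).indicator (f - g)) (C * τ ^ (1 - q) * S.energy q f Q)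

variable {S}

theorem energy_nonneg (q : ℝ) (f : S.V → ℂ) (Q : Finset S.V) : 0 ≤ S.energy q f Q :=
  Finset.sum_nonneg fun x _ => mul_nonneg (S.wt_pos x).le (by positivity)

theorem energy_mono (q : ℝ) (f : S.V → ℂ) {P Q : Finset S.V} (h : P ⊆ Q) :
    S.energy q f P ≤ S.energy q f Q :=
  Finset.sum_le_sum_of_subset_of_nonneg h fun x _ _ =>
    mul_nonneg (S.wt_pos x).le (by positivity)

theorem HasSplitting.empty {B C q τ : ℝ} {f : S.V → ℂ} : S.HasSplitting B C q τ f ∅ :=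
  ⟨0, by simp, by simp, by
    rw [Finset.coe_empty, indicator_empty']
    exact .zero (by simp [energy])⟩

theorem HasSplitting.union [DecidableEq S.V] {B C q τ : ℝ} {f : S.V → ℂ} {P Q : Finset S.V}
    (hP : S.HasSplitting B C q τ f P) (hQ : S.HasSplitting B C q τ f Q) (h : Disjoint P Q) :
    S.HasSplitting B C q τ f (P ∪ Q) := by
  obtain ⟨g, g1, g2, g3⟩ := hP
  obtain ⟨k, k1, k2, k3⟩ := hQ
  have hQP : ∀ x ∈ Q, x ∉ P := fun x hx hx' => Finset.disjoint_left.1 h hx' hx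
  refine ⟨fun x => if x ∈ P then g x else k x, ?_, ?_, ?_⟩
  · intro x hx
    by_cases hxP : x ∈ P
    · simpa [hxP] using g1 x hxP
    · simpa [hxP] using k1 x ((Finset.mem_union.1 hx).resolve_left hxP)
  · rw [Finset.sum_union h, Finset.sum_union h, ← g2, ← k2]
    congr 1
    · exact Finset.sum_congr rfl fun x hx => by simp [hx]
    · exact Finset.sum_congr rfl fun x hx => by simp [hQP x hx]
  · convert g3.add k3 using 1
    · ext x
      by_cases hxP : x ∈ P
      · have : x ∉ Q := fun hx => hQP x hx hxP
        simp [indicator, hxP, this]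
      · by_cases hxQ : x ∈ Q <;> simp [indicator, hxP, hxQ]
    · rw [← mul_add, energy, Finset.sum_union h]
      rfl

theorem HasSplitting.biUnion [DecidableEq S.V] {B C q τ : ℝ} {f : S.V → ℂ} {ι : Type}
    {I : Finset ι} {P : ι → Finset S.V}
    (disj : ∀ i ∈ I, ∀ j ∈ I, ∀ z, z ∈ P i → z ∈ P j → i = j)
    (h : ∀ i ∈ I, S.HasSplitting B C q τ f (P i)) :
    S.HasSplitting B C q τ f (I.biUnion P) := by
  classical
  induction I using Finset.induction_on with
  | empty => exact .empty
  | insert i I hi ih =>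
    rw [Finset.biUnion_insert]
    refine (h i (Finset.mem_insert_self _ _)).union
      (ih (fun j hj k hk => disj j (Finset.mem_insert_of_mem hj) k (Finset.mem_insert_of_mem hk))
        fun j hj => h j (Finset.mem_insert_of_mem hj)) (Finset.disjoint_left.2 fun z hz hz' => ?_)
    obtain ⟨j, hj, hz'⟩ := Finset.mem_biUnion.1 hz'
    exact hi (disj i (Finset.mem_insert_self _ _) j (Finset.mem_insert_of_mem hj) z hz hz' ▸ hj)

theorem norm_le_add_rpow {q τ t : ℝ} (hq : 1 < q) (hτ : 0 < τ) (ht : 0 ≤ t) :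
    t ≤ τ + τ ^ (1 - q) * t ^ q := by
  rcases le_or_gt t τ with h | h
  · have : 0 ≤ τ ^ (1 - q) * t ^ q := by positivity
    linarith
  · have ht' : 0 < t := hτ.trans h
    have e : t ^ (1 - q) * t ^ q = t := by
      rw [← Real.rpow_add ht']; simp
    have : t ^ (1 - q) ≤ τ ^ (1 - q) :=
      Real.rpow_le_rpow_of_nonpos hτ h.le (by linarith)
    have : t ^ (1 - q) * t ^ q ≤ τ ^ (1 - q) * t ^ q := by gcongr
    linarith

theorem norm_sum_wt_mul_le {q τ D : ℝ} (hq : 1 < q) (hτ : 0 < τ) {f : S.V → ℂ}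
    {Q : Finset S.V} (h : S.energy q f Q ≤ D * τ ^ q * S.vol Q) :
    ‖∑ x ∈ Q, (S.wt x : ℂ) * f x‖ ≤ (1 + D) * τ * S.vol Q := by
  have h1 : ‖∑ x ∈ Q, (S.wt x : ℂ) * f x‖ ≤ ∑ x ∈ Q, S.wt x * ‖f x‖ := by
    refine (norm_sum_le _ _).trans (Finset.sum_le_sum fun x _ => ?_)
    rw [norm_mul, Complex.norm_real, Real.norm_of_nonneg (S.wt_pos x).le]
  have h2 : ∑ x ∈ Q, S.wt x * ‖f x‖ ≤ τ * S.vol Q + τ ^ (1 - q) * S.energy q f Q := by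
    rw [vol, energy, Finset.mul_sum, Finset.mul_sum, ← Finset.sum_add_distrib]
    refine Finset.sum_le_sum fun x _ => ?_
    calc S.wt x * ‖f x‖ ≤ S.wt x * (τ + τ ^ (1 - q) * ‖f x‖ ^ q) :=
          mul_le_mul_of_nonneg_left (norm_le_add_rpow hq hτ (norm_nonneg _)) (S.wt_pos x).le
      _ = _ := by ring
  have h3 : τ ^ (1 - q) * S.energy q f Q ≤ τ ^ (1 - q) * (D * τ ^ q * S.vol Q) := by gcongr
  have h4 : τ ^ (1 - q) * (D * τ ^ q * S.vol Q) = D * τ * S.vol Q := by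
    have : τ ^ (1 - q) * τ ^ q = τ := by rw [← Real.rpow_add hτ]; simp
    linear_combination D * S.vol Q * this
  linarith

theorem HasSplitting.of_stopped {B C q τ A D : ℝ} (hq : 1 < q) (hτ : 0 < τ) (hA : 0 < A)
    (hA2 : A ^ (1 - q) ≤ 1 / 2) (hB : 1 + D ≤ B) (hB0 : 0 ≤ B) (hC : 28 * B * A ≤ C)
    {f : S.V → ℂ} {Q : Finset S.V}
    (hE : ∃ E : Finset S.V, S.IsCZ E ∧ Q ⊆ E ∧ S.vol E ≤ 7 * S.vol Q)
    (hlow : τ ^ q * S.vol Q < S.energy q f Q) (hup : S.energy q f Q ≤ D * τ ^ q * S.vol Q)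
    (h : S.HasSplitting B C q (A * τ) f Q) : S.HasSplitting B C q τ f Q := by
  obtain ⟨g, g1, g2, g3⟩ := h
  obtain ⟨E, hE, hQE, hEv⟩ := hE
  have hv : 0 < S.vol Q := by
    have := vol_pos_of_isCZ hE
    linarith
  set M : ℂ := (S.vol Q : ℂ)⁻¹ * ∑ x ∈ Q, (S.wt x : ℂ) * f x with hM
  have hvc : (S.vol Q : ℂ) ≠ 0 := by exact_mod_cast hv.ne'
  have hMsum : ∑ x ∈ Q, (S.wt x : ℂ) * M = ∑ x ∈ Q, (S.wt x : ℂ) * f x := by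
    rw [← Finset.sum_mul, hM, ← mul_assoc]
    have : ∑ x ∈ Q, (S.wt x : ℂ) = S.vol Q := by rw [vol]; push_cast; rfl
    rw [this, mul_inv_cancel₀ hvc, one_mul]
  have hMle (K : ℝ) (hK : ‖∑ x ∈ Q, (S.wt x : ℂ) * f x‖ ≤ K * S.vol Q) : ‖M‖ ≤ K := by
    rw [hM, norm_mul, norm_inv, Complex.norm_real, Real.norm_of_nonneg hv.le]
    rwa [inv_mul_le_iff₀ hv, mul_comm (S.vol Q)]
  have hM1 : ‖M‖ ≤ B * τ :=
    (hMle _ (norm_sum_wt_mul_le hq hτ hup)).trans (by gcongr)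
  have hM2 : ‖M‖ ≤ B * (A * τ) := by
    refine hMle _ ?_
    rw [← g2, vol, Finset.mul_sum]
    refine (norm_sum_le _ _).trans (Finset.sum_le_sum fun x hx => ?_)
    rw [norm_mul, Complex.norm_real, Real.norm_of_nonneg (S.wt_pos x).le, mul_comm]
    exact mul_le_mul_of_nonneg_right (g1 x hx) (S.wt_pos x).le
  refine ⟨fun _ => M, fun x _ => hM1, hMsum, ?_⟩
  have hcost : S.AtomicCost ((Q : Set S.V).indicator (g - fun _ => M))
      (2 * (B * (A * τ)) * S.vol E) := by
    refine atomicCost_of_norm_le hE (fun x hx => hQE ?_) (fun x => ?_) ?_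
    · by_contra hxQ
      exact hx (indicator_of_notMem hxQ _)
    · by_cases hx : x ∈ Q
      · rw [indicator_of_mem (by exact hx)]
        refine (norm_sub_le _ _).trans ?_
        have := g1 x hx
        linarith
      · rw [indicator_of_notMem (by exact hx), norm_zero]
        positivity
    · rw [← Finset.sum_subset hQE fun x _ hx => by
        rw [indicator_of_notMem (by exact hx), mul_zero]]
      rw [Finset.sum_congr rfl fun x hx => by
        rw [indicator_of_mem (by exact hx), Pi.sub_apply, mul_sub], Finset.sum_sub_distrib, g2,
        hMsum, sub_self]
  have hsum : (Q : Set S.V).indicator (f - fun _ => M) =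
      (Q : Set S.V).indicator (f - g) + (Q : Set S.V).indicator (g - fun _ => M) := by
    rw [← indicator_add']
    congr 1
    abel
  rw [hsum]
  refine (g3.add hcost).mono ?_
  have hτq : τ ^ (1 - q) * τ ^ q = τ := by rw [← Real.rpow_add hτ]; simp
  have hτp : 0 < τ ^ (1 - q) := by positivity
  have hI := energy_nonneg q f Q
  have e1 : τ * S.vol Q ≤ τ ^ (1 - q) * S.energy q f Q := by
    calc τ * S.vol Q = τ ^ (1 - q) * (τ ^ q * S.vol Q) := by
          linear_combination -(S.vol Q) * hτq
      _ ≤ _ := by gcongr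
  have hC0 : 0 ≤ C := le_trans (by positivity) hC
  have e2 : C * (A * τ) ^ (1 - q) * S.energy q f Q ≤
      C / 2 * (τ ^ (1 - q) * S.energy q f Q) := by
    rw [Real.mul_rpow hA.le hτ.le]
    calc C * (A ^ (1 - q) * τ ^ (1 - q)) * S.energy q f Q
        ≤ C * (1 / 2 * τ ^ (1 - q)) * S.energy q f Q := by gcongr
      _ = _ := by ring
  have e3 : 2 * (B * (A * τ)) * S.vol E ≤ C / 2 * (τ ^ (1 - q) * S.energy q f Q) := by
    calc 2 * (B * (A * τ)) * S.vol E ≤ 2 * (B * (A * τ)) * (7 * S.vol Q) := by gcongr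
      _ = 28 * B * A / 2 * (τ * S.vol Q) := by ring
      _ ≤ C / 2 * (τ ^ (1 - q) * S.energy q f Q) := by gcongr
  linarith

theorem Dyadic.hasSplitting {q A D B C : ℝ} (hq : 1 < q) (hD : 1 ≤ D) (hDm : 2 * (m : ℝ) ^ 2 ≤ D)
    (hAD : D ≤ A) (hA2 : A ^ (1 - q) ≤ 1 / 2) (hB : 1 + D ≤ B) (hC : 28 * B * A ≤ C)
    {Q : Finset S.V} (hQ : S.Dyadic Q) (f : S.V → ℂ) {τ : ℝ} (hτ : 0 < τ)
    (h : S.energy q f Q ≤ D * τ ^ q * S.vol Q) : S.HasSplitting B C q τ f Q := by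
  classical
  have hA1 : 1 ≤ A := hD.trans hAD
  have hA : 0 < A := by linarith
  have hB0 : 0 ≤ B := by linarith
  have hC0 : 0 ≤ C := le_trans (by positivity) hC
  induction hQ generalizing τ with
  | singleton x =>
    refine ⟨f, fun y hy => ?_, rfl, ?_⟩
    · obtain rfl := Finset.mem_singleton.1 hy
      rw [energy, Finset.sum_singleton, vol_singleton, mul_comm,
        mul_le_mul_iff_of_pos_right (S.wt_pos y)] at h
      have hDq : D ≤ D ^ q := Real.self_le_rpow_of_one_le hD hq.le
      have : ‖f y‖ ^ q ≤ (D * τ) ^ q := by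
        rw [Real.mul_rpow (by linarith) hτ.le]
        exact h.trans (by gcongr)
      rw [Real.rpow_le_rpow_iff (norm_nonneg _) (by positivity) (by linarith)] at this
      exact this.trans (by gcongr; linarith)
    · simp only [sub_self, indicator_zero']
      exact .zero (mul_nonneg (by positivity) (energy_nonneg _ _ _))
  | node Q I P mem_iff disj dyadic regular comparable ih =>
    have low {σ : ℝ} (hσ : 0 < σ) (hI : S.energy q f Q ≤ σ ^ q * S.vol Q) :
        S.HasSplitting B C q σ f Q := by
      have hQ : Q = I.biUnion P := by
        ext z
        rw [mem_iff, Finset.mem_biUnion]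
      rw [hQ]
      refine .biUnion disj fun i hi => ih i hi hσ ?_
      have hsub : P i ⊆ Q := fun z hz => (mem_iff z).2 ⟨i, hi, hz⟩
      have hσq : 0 < σ ^ q := by positivity
      calc S.energy q f (P i) ≤ S.energy q f Q := energy_mono q f hsub
        _ ≤ σ ^ q * S.vol Q := hI
        _ ≤ σ ^ q * (2 * m ^ 2 * S.vol (P i)) := by gcongr; exact regular i hi
        _ ≤ σ ^ q * (D * S.vol (P i)) := by
          have := S.vol_nonneg (P i)
          gcongr
        _ = _ := by ring
    rcases le_or_gt (S.energy q f Q) (τ ^ q * S.vol Q) with hI | hI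
    · exact low hτ hI
    · refine .of_stopped hq hτ hA hA2 hB hB0 hC comparable hI h
        (low (by positivity) (h.trans ?_))
      have hDq : D ≤ A ^ q := hAD.trans (Real.self_le_rpow_of_one_le hA1 hq.le)
      have := S.vol_nonneg Q
      rw [Real.mul_rpow hA.le hτ.le]
      gcongr

theorem IsAtom.integrable {p : ℝ≥0∞} {a : S.V → ℂ} (h : S.IsAtom p a) : Integrable a S.μ := by
  obtain ⟨R, hs, -⟩ := h
  obtain ⟨Q, -, hQ⟩ := S.exists_dyadic_eq_env R
  exact S.integrable_of_support_subset (hQ ▸ hs)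

theorem isAtom_zero (S : HomTreeSetting m) (p : ℝ≥0∞) : S.IsAtom p 0 := by
  obtain ⟨x⟩ := S.conn.nonempty
  exact ⟨⟨x, 1, le_rfl, true, fun _ => rfl⟩, by simp, by simp, by simp⟩

theorem IsAtom.of_top {p : ℝ≥0∞} {a : S.V → ℂ} (h : S.IsAtom ⊤ a) : S.IsAtom p a := by
  obtain ⟨R, hs, hn, h0⟩ := h
  refine ⟨R, hs, ?_, h0⟩
  obtain ⟨Q, hQd, hQ⟩ := S.exists_dyadic_eq_env R
  have hpos : S.μ R.env ≠ 0 := by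
    have := vol_pos_of_isCZ (E := Q) ⟨R, hQ⟩
    rw [← measureReal_finset, hQ] at this
    exact (ENNReal.toReal_pos_iff.1 this).1.ne'
  have htop : S.μ R.env ≠ ∞ := hQ ▸ S.measure_finset_ne_top Q
  rw [← eLpNorm_restrict_eq_of_support_subset hs] at hn ⊢
  refine (eLpNorm_le_eLpNorm_mul_rpow_measure_univ le_top
    (S.measurable a).aestronglyMeasurable).trans ?_
  rw [Measure.restrict_apply_univ]
  refine (mul_le_mul_left hn _).trans ?_
  rw [← ENNReal.rpow_add _ _ hpos htop]
  simp
  ring_nf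
  simp

theorem ofReal_energy_le {q : ℝ} (hq : 0 < q) (f : S.V → ℂ) (Q : Finset S.V) :
    ENNReal.ofReal (S.energy q f Q) ≤ ∫⁻ x, ‖f x‖ₑ ^ q ∂S.μ := by
  refine le_trans ?_ (setLIntegral_le_lintegral (Q : Set S.V) _)
  rw [lintegral_finset, energy, ENNReal.ofReal_sum_of_nonneg fun x _ =>
    mul_nonneg (S.wt_pos x).le (by positivity)]
  refine Finset.sum_le_sum fun x _ => ?_
  rw [ENNReal.ofReal_mul (S.wt_pos x).le, ← ENNReal.ofReal_rpow_of_nonneg (norm_nonneg _) hq.le,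
    ofReal_norm, wt, Measure.real, ENNReal.ofReal_toReal (S.measure_singleton_ne_top x), mul_comm]

theorem energy_le_of_eLpNorm_le {p : ℝ≥0∞} (hp : 1 < p) (hp' : p ≠ ⊤) {a : S.V → ℂ}
    {Q : Finset S.V} (hv : 0 < S.vol Q)
    (h : eLpNorm a p S.μ ≤ S.μ Q ^ ((p⁻¹).toReal - 1)) :
    S.energy p.toReal a Q ≤ (S.vol Q)⁻¹ ^ p.toReal * S.vol Q := by
  have hp0 : p ≠ 0 := (zero_lt_one.trans hp).ne'
  have hq : 0 < p.toReal := ENNReal.toReal_pos hp0 hp'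
  have hμ : S.μ Q = ENNReal.ofReal (S.vol Q) := by
    rw [← measureReal_finset, Measure.real, ENNReal.ofReal_toReal (S.measure_finset_ne_top Q)]
  rw [eLpNorm_eq_lintegral_rpow_enorm_toReal hp0 hp', hμ, ENNReal.ofReal_rpow_of_pos hv] at h
  have h1 := ENNReal.rpow_le_rpow h hq.le
  rw [← ENNReal.rpow_mul, one_div, inv_mul_cancel₀ hq.ne', ENNReal.rpow_one,
    ENNReal.ofReal_rpow_of_nonneg (by positivity) hq.le] at h1
  have h2 := (ENNReal.ofReal_le_ofReal_iff (by positivity)).1 ((ofReal_energy_le hq a Q).trans h1)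
  refine h2.trans_eq ?_
  rw [← Real.rpow_mul hv.le, Real.inv_rpow hv.le, ← Real.rpow_neg hv.le, ENNReal.toReal_inv,
    sub_mul, inv_mul_cancel₀ hq.ne', one_mul, sub_eq_neg_add, Real.rpow_add hv, Real.rpow_one]

/-- Every `(1,p)`-atom is a finite combination of `(1,∞)`-atoms, with uniformly bounded total
coefficient. -/
theorem exists_atomicCost (S : HomTreeSetting m) {p : ℝ≥0∞} (hp : 1 < p) (hp' : p ≠ ⊤) :
    ∃ K : ℝ, 0 < K ∧ ∀ a, S.IsAtom p a → S.AtomicCost a K := by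
  have hq : 1 < p.toReal := by
    rw [← ENNReal.toReal_one]
    exact (ENNReal.toReal_lt_toReal (by simp) hp').2 hp
  set q := p.toReal with hqdef
  set D : ℝ := 2 * (m : ℝ) ^ 2 with hD
  set A : ℝ := max D (2 ^ (1 / (q - 1))) with hA
  have hD1 : 1 ≤ D := by
    have := S.two_le_cast
    nlinarith
  have hAD : D ≤ A := le_max_left _ _
  have hA2 : A ^ (1 - q) ≤ 1 / 2 := by
    calc A ^ (1 - q) ≤ ((2 : ℝ) ^ (1 / (q - 1))) ^ (1 - q) :=
          Real.rpow_le_rpow_of_nonpos (by positivity) (le_max_right _ _) (by linarith)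
      _ = 1 / 2 := by
        rw [← Real.rpow_mul (by norm_num),
          show 1 / (q - 1) * (1 - q) = -1 by
            have : q - 1 ≠ 0 := by linarith
            field_simp
            ring, Real.rpow_neg_one, one_div]
  have hB : 0 < 1 + D := by linarith
  have hA0 : 0 < A := by linarith
  refine ⟨28 * (1 + D) * A + (1 + D), by positivity, fun a ha => ?_⟩
  obtain ⟨R, hs, hn, h0⟩ := ha
  obtain ⟨Q, hQd, hQ⟩ := S.exists_dyadic_eq_env R
  rw [← hQ] at hs hn
  have hCZ : S.IsCZ Q := ⟨R, hQ⟩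
  have hv := vol_pos_of_isCZ hCZ
  have hE := energy_le_of_eLpNorm_le hp hp' hv hn
  obtain ⟨g, g1, g2, g3⟩ := hQd.hasSplitting hq hD1 le_rfl hAD hA2 le_rfl le_rfl a
    (inv_pos.2 hv) (hE.trans (by
      rw [mul_assoc]
      exact le_mul_of_one_le_left (by positivity) hD1))
  have hg : S.AtomicCost ((Q : Set S.V).indicator g) ((1 + D) * (S.vol Q)⁻¹ * S.vol Q) := by
    refine atomicCost_of_norm_le hCZ support_indicator_subset (fun x => ?_) ?_
    · by_cases hx : x ∈ (Q : Set S.V)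
      · rw [indicator_of_mem hx]
        exact g1 x hx
      · rw [indicator_of_notMem hx, norm_zero]
        positivity
    · rw [S.integral_eq_sum hs] at h0
      rw [← h0, ← g2]
      exact Finset.sum_congr rfl fun x hx => by rw [indicator_of_mem (by exact hx)]
  have ha : a = (Q : Set S.V).indicator (a - g) + (Q : Set S.V).indicator g := by
    rw [← indicator_add', sub_add_cancel, indicator_eq_self.2 hs]
  rw [ha]
  refine (g3.add hg).mono (add_le_add ?_ ?_)
  · rw [mul_assoc]
    refine mul_le_of_le_one_right (by positivity) ?_
    calc (S.vol Q)⁻¹ ^ (1 - q) * S.energy q a Q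
        ≤ (S.vol Q)⁻¹ ^ (1 - q) * ((S.vol Q)⁻¹ ^ q * S.vol Q) := by gcongr
      _ = 1 := by
        rw [← mul_assoc, ← Real.rpow_add (inv_pos.2 hv), sub_add_cancel, Real.rpow_one,
          inv_mul_cancel₀ hv.ne']
  · rw [mul_assoc, inv_mul_cancel₀ hv.ne', mul_one]

theorem AtomicCost.exists_sum_range {b : S.V → ℂ} {K : ℝ} (h : S.AtomicCost b K) :
    ∃ (n : ℕ) (c : ℕ → ℂ) (a : ℕ → S.V → ℂ), (∀ j, S.IsAtom ⊤ (a j)) ∧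
      (∀ j ∉ Finset.range n, c j = 0) ∧ b = ∑ j ∈ Finset.range n, c j • a j ∧
      ∑ j ∈ Finset.range n, ‖c j‖ ≤ K := by
  obtain ⟨L, h1, h2, h3⟩ := h
  refine ⟨L.length, fun j => (L.getD j (0, 0)).1, fun j => (L.getD j (0, 0)).2, fun j => ?_,
    fun j hj => ?_, ?_, ?_⟩
  · beta_reduce
    by_cases hj : j < L.length
    · rw [List.getD_eq_getElem _ _ hj]
      exact h1 _ (List.getElem_mem hj)
    · rw [List.getD_eq_default _ _ (not_lt.1 hj)]
      exact S.isAtom_zero ⊤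
  · beta_reduce
    rw [List.getD_eq_default _ _ (by simpa using hj)]
  · rw [h2, List.sum_map_eq_sum_range_getD L (0, 0)]
  · rwa [← List.sum_map_eq_sum_range_getD L (0, 0) fun u => ‖u.1‖]

theorem IsAtom.memLp {p : ℝ≥0∞} {a : S.V → ℂ} (h : S.IsAtom p a) : MemLp a 1 S.μ :=
  memLp_one_iff_integrable.2 h.integrable

theorem IsAtom.norm_toLp_le {a : S.V → ℂ} (h : S.IsAtom ⊤ a) : ‖h.memLp.toLp a‖ ≤ 1 := by
  rw [Lp.norm_toLp]
  obtain ⟨R, -, hn, -⟩ := h.of_top (p := 1)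
  refine ENNReal.toReal_le_of_le_ofReal zero_le_one (hn.trans ?_)
  simp

theorem tendsto_eLpNorm_sub_sum_iff {f : S.V → ℂ} (hf : MemLp f 1 S.μ) {c : ℕ → ℂ}
    {a : ℕ → S.V → ℂ} (ha : ∀ j, MemLp (a j) 1 S.μ) :
    Tendsto (fun n => eLpNorm (fun x => f x - ∑ j ∈ Finset.range n, c j * a j x) 1 S.μ)
      atTop (nhds 0) ↔
    Tendsto (fun n => ∑ j ∈ Finset.range n, c j • (ha j).toLp (a j)) atTop
      (nhds (hf.toLp f)) := by
  have hmem (n : ℕ) : MemLp (∑ j ∈ Finset.range n, c j • a j) 1 S.μ :=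
    memLp_finsetSum' _ fun j _ => (ha j).const_smul (c j)
  have hsum (n : ℕ) : ∑ j ∈ Finset.range n, c j • (ha j).toLp (a j) =
      (hmem n).toLp (∑ j ∈ Finset.range n, c j • a j) := by
    induction n with
    | zero => rfl
    | succ n ih =>
      rw [Finset.sum_range_succ, ih, ← MemLp.toLp_const_smul, ← MemLp.toLp_add]
      congr 1
      rw [Finset.sum_range_succ]
  simp_rw [hsum]
  rw [Lp.tendsto_Lp_iff_tendsto_eLpNorm'']
  refine iff_of_eq (congrArg (fun u => Tendsto u atTop (nhds 0)) (funext fun n => ?_))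
  rw [eLpNorm_sub_comm]
  congr 1
  ext x
  simp

theorem IsAtomicDecomp.exists_top {p : ℝ≥0∞} {K : ℝ}
    (hK : ∀ a, S.IsAtom p a → S.AtomicCost a K) {f : S.V → ℂ} (hf : Integrable f S.μ)
    {c : ℕ → ℂ} {a : ℕ → S.V → ℂ} (h : S.IsAtomicDecomp p f c a) :
    ∃ c' a', S.IsAtomicDecomp ⊤ f c' a' ∧ ∑' j, ‖c' j‖ ≤ K * ∑' j, ‖c j‖ := by
  obtain ⟨ha, hc, hlim⟩ := h
  have hf' : MemLp f 1 S.μ := memLp_one_iff_integrable.2 hf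
  rw [tendsto_eLpNorm_sub_sum_iff hf' fun j => (ha j).memLp] at hlim
  choose n d b hb hd hab hdK using fun j => (hK _ (ha j)).exists_sum_range
  let F : ℕ × ℕ → ℂ := fun i => c i.1 * d i.1 i.2
  let G : ℕ × ℕ → Lp ℂ 1 S.μ := fun i => F i • (hb i.1 i.2).memLp.toLp (b i.1 i.2)
  have hin (j : ℕ) : HasSum (fun k => ‖F (j, k)‖) (∑ k ∈ Finset.range (n j), ‖F (j, k)‖) :=
    hasSum_sum_of_ne_finset_zero fun k hk => by simp [F, hd j k hk]
  have hin_le (j : ℕ) : ∑ k ∈ Finset.range (n j), ‖F (j, k)‖ ≤ K * ‖c j‖ := by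
    simp only [F, norm_mul]
    rw [← Finset.mul_sum, mul_comm]
    gcongr
    exact hdK j
  have hFout : Summable fun j => ∑' k, ‖F (j, k)‖ :=
    Summable.of_nonneg_of_le (fun j => tsum_nonneg fun k => norm_nonneg _)
      (fun j => (hin j).tsum_eq.trans_le (hin_le j)) (hc.mul_left K)
  have hF : Summable fun i => ‖F i‖ :=
    (summable_prod_of_nonneg fun i => norm_nonneg _).2 ⟨fun j => (hin j).summable, hFout⟩
  have hFle : ∑' i, ‖F i‖ ≤ K * ∑' j, ‖c j‖ := by
    rw [hF.tsum_prod, ← tsum_mul_left]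
    exact hFout.tsum_le_tsum (fun j => (hin j).tsum_eq.trans_le (hin_le j)) (hc.mul_left K)
  have hG : Summable G := by
    refine Summable.of_norm_bounded hF fun i => ?_
    rw [norm_smul]
    exact mul_le_of_le_one_right (norm_nonneg _) (hb i.1 i.2).norm_toLp_le
  have hGin (j : ℕ) : HasSum (fun k => G (j, k)) (c j • (ha j).memLp.toLp (a j)) := by
    have hsum : c j • (ha j).memLp.toLp (a j) = ∑ k ∈ Finset.range (n j), G (j, k) := by
      simp only [G, F, mul_smul]
      rw [← Finset.smul_sum]
      congr 1
      have key := (tendsto_eLpNorm_sub_sum_iff (c := d j) (ha j).memLp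
        fun k => (hb j k).memLp).1 (tendsto_atTop_of_eventually_const (i₀ := n j) fun i hi => ?_)
      · exact tendsto_nhds_unique key (tendsto_atTop_of_eventually_const (i₀ := n j) fun i hi =>
          (Finset.sum_subset (Finset.range_mono hi) fun k _ hk => by
            rw [hd j k hk, zero_smul]).symm)
      · have : (fun x => a j x - ∑ k ∈ Finset.range i, d j k * b j k x) = 0 := by
          ext x
          rw [hab j, ← Finset.sum_subset (Finset.range_mono hi) fun k _ hk => by
            rw [hd j k hk, zero_mul]]
          simp
        rw [this, eLpNorm_zero]
    rw [hsum]
    exact hasSum_sum_of_ne_finset_zero fun k hk => by simp [G, F, hd j k hk]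
  have hfG : HasSum G (hf'.toLp f) := by
    have := (hG.hasSum.prod_fiberwise hGin).tendsto_sum_nat
    rw [tendsto_nhds_unique hlim this]
    exact hG.hasSum
  let e : ℕ ≃ ℕ × ℕ := Nat.pairEquiv.symm
  refine ⟨fun j => F (e j), fun j => b (e j).1 (e j).2, ⟨fun j => hb _ _, ?_, ?_⟩, ?_⟩
  · exact (e.summable_iff (f := fun i => ‖F i‖)).2 hF
  · rw [tendsto_eLpNorm_sub_sum_iff hf' fun j => (hb (e j).1 (e j).2).memLp]
    exact ((e.hasSum_iff (f := G)).2 hfG).tendsto_sum_nat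
  · rw [e.tsum_eq fun i => ‖F i‖]
    exact hFle

theorem IsAtomicDecomp.of_top {p : ℝ≥0∞} {f : S.V → ℂ} {c : ℕ → ℂ} {a : ℕ → S.V → ℂ}
    (h : S.IsAtomicDecomp ⊤ f c a) : S.IsAtomicDecomp p f c a :=
  ⟨fun j => (h.1 j).of_top, h.2⟩

theorem h1Norm_le {p : ℝ≥0∞} {f : S.V → ℂ} {c : ℕ → ℂ} {a : ℕ → S.V → ℂ}
    (h : S.IsAtomicDecomp p f c a) : S.h1Norm p f ≤ ∑' j, ‖c j‖ := by
  refine csInf_le ⟨0, ?_⟩ ⟨c, a, h, rfl⟩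
  rintro _ ⟨c, a, -, rfl⟩
  exact tsum_nonneg fun j => norm_nonneg _

theorem le_h1Norm {p : ℝ≥0∞} {f : S.V → ℂ} (hf : S.MemH1 p f) {t : ℝ}
    (h : ∀ c a, S.IsAtomicDecomp p f c a → t ≤ ∑' j, ‖c j‖) : t ≤ S.h1Norm p f := by
  obtain ⟨-, c, a, hca⟩ := hf
  refine le_csInf ⟨_, c, a, hca, rfl⟩ ?_
  rintro _ ⟨c, a, hca, rfl⟩
  exact h c a hca

end HomTreeSetting

/-- For every `p ∈ (1,∞)` the Hardy spaces `H^{1,p}(μ)` and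
`H^{1,∞}(μ)` coincide and there is `C_p > 0` with
`‖f‖_{H^{1,p}} ≤ ‖f‖_{H^{1,∞}} ≤ C_p ‖f‖_{H^{1,p}}` for all `f ∈ H^{1,p}(μ)`. -/
theorem hardy_spaces_coincide (m : ℕ) (S : HomTreeSetting m)
    (p : ℝ≥0∞) (hp : 1 < p) (hp' : p ≠ ⊤) :
    (∀ f : S.V → ℂ, S.MemH1 p f ↔ S.MemH1 ⊤ f) ∧
    ∃ C : ℝ, 0 < C ∧ ∀ f : S.V → ℂ, S.MemH1 p f →
      S.h1Norm p f ≤ S.h1Norm ⊤ f ∧ S.h1Norm ⊤ f ≤ C * S.h1Norm p f := by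
  obtain ⟨K, hK0, hK⟩ := S.exists_atomicCost hp hp'
  have hmem (f : S.V → ℂ) : S.MemH1 p f ↔ S.MemH1 ⊤ f := by
    constructor
    · rintro ⟨hf, c, a, h⟩
      obtain ⟨c', a', h', -⟩ := h.exists_top hK hf
      exact ⟨hf, c', a', h'⟩
    · rintro ⟨hf, c, a, h⟩
      exact ⟨hf, c, a, h.of_top⟩
  refine ⟨hmem, K, hK0, fun f hf => ⟨?_, ?_⟩⟩
  · exact HomTreeSetting.le_h1Norm ((hmem f).1 hf) fun c a h => HomTreeSetting.h1Norm_le h.of_top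
  · rw [← div_le_iff₀' hK0]
    refine HomTreeSetting.le_h1Norm hf fun c a h => ?_
    obtain ⟨c', a', h', hle⟩ := h.exists_top hK hf.1
    rw [div_le_iff₀' hK0]
    exact (HomTreeSetting.h1Norm_le h').trans hle
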